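/- Let (K₁,e₁) and (K₂,e₂) be compactifications of a topological space Ω with a projection Φ : K₂ → K₁, and let x₀ ∈ K₁ and x̂ ∈ K₂ be such that Φ⁻¹({x₀}) = {x̂}. Then the trace filters coincide: comap e₁ (𝓝 x₀) = comap e₂ (𝓝 x̂) as filters on Ω. Equivalently, for every filter l on Ω, e₁ tends to x₀ along l if and only if e₂ tends to x̂ along l (a net in Ω converges to x₀ in K₁ if and only if it converges to x̂ in K₂). (This is the key step in the paper's proof that when the fiber over x₀ is a single point, x₀ is regular with respect to the smaller compactification if and only if x̂ is regular with respect to the larger one.) -/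

import Mathlib

open Filter Topology

/-- If the fiber of the projection `Φ` over `x₀` is the single point `xh`,
then the trace filters of `Ω` at `x₀` and at `xh` coincide; equivalently, a net in `Ω`
converges to `x₀` in the smaller compactification iff it converges to `xh` in the
larger one. -/
theorem traceFilter_eq_of_fiber_singleton
    {Ω K₁ K₂ : Type*} [TopologicalSpace Ω] [TopologicalSpace K₁] [TopologicalSpace K₂]
    [CompactSpace K₁] [T2Space K₁] [CompactSpace K₂] [T2Space K₂]
    {e₁ : Ω → K₁} {e₂ : Ω → K₂}
    (he₁ : IsEmbedding e₁) (hd₁ : DenseRange e₁)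
    (he₂ : IsEmbedding e₂) (hd₂ : DenseRange e₂)
    {Φ : K₂ → K₁} (hΦ : Continuous Φ) (hΦe : Φ ∘ e₂ = e₁)
    (x₀ : K₁) (xh : K₂) (hfib : Φ ⁻¹' {x₀} = {xh}) :
    Filter.comap e₁ (𝓝 x₀) = Filter.comap e₂ (𝓝 xh) ∧
    (∀ l : Filter Ω, Filter.Tendsto e₁ l (𝓝 x₀) ↔ Filter.Tendsto e₂ l (𝓝 xh)) := by
  have h : comap e₁ (𝓝 x₀) = comap e₂ (𝓝 xh) := by
    rw [← hΦe, ← comap_comap, hΦ.isClosedMap.comap_nhds_eq hΦ, hfib, nhdsSet_singleton]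
  exact ⟨h, fun l => by rw [tendsto_iff_comap, tendsto_iff_comap, h]⟩
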